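/- Let T be a Calderón–Zygmund operator with normalised standard kernel of Hölder exponent γ, s ∈ ℕ, and let f be a function with finite Haar expansion. Then, almost everywhere on Σ_{f,s}^c: T f = Φ̃_s f + Ψ_s f, where Φ̃_s f := Σ_{m∈ℤⁿ} Σ_{η∈{0,1}ⁿ∖{0}} Σ_{I∈𝒟} (h⁰_{I^{(s)}∔m} − h⁰_{I^{(s)}}) ⟨h⁰_{I^{(s)}∔m}, T h^η_I⟩ ⟨h^η_I, f⟩ and Ψ_s f := Σ_{k∈ℤ} (Id − E_k) T_{4·2^{−k}} D_{k+s} f. -/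

import Mathlib

open MeasureTheory

noncomputable section

open Classical in
/-- Classical indicator of a proposition. -/
def indR (P : Prop) : ℝ := if P then 1 else 0

/-- The real sign associated to a boolean. -/
def sgnB (b : Bool) : ℝ := if b then 1 else -1

/-- The `ℓ∞` norm of an integer vector, as a real number. -/
def inorm {n : ℕ} (m : Fin n → ℤ) : ℝ := ‖(fun i => (m i : ℝ) : Fin n → ℝ)‖

/-- The dyadic cube `2^{-k}([0,1)^n + m)` of generation `k` in `ℝ^n` (with the `ℓ∞` metric). -/
def dyadicCube (n : ℕ) (k : ℤ) (m : Fin n → ℤ) : Set (Fin n → ℝ) :=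
  {x | ∀ i, (2:ℝ) ^ (-k) * m i ≤ x i ∧ x i < (2:ℝ) ^ (-k) * (m i + 1)}

/-- The side length `2^{-k}` of a dyadic cube of generation `k`. -/
def sideLen (k : ℤ) : ℝ := (2:ℝ) ^ (-k)

/-- One-dimensional Haar function on the dyadic interval `2^{-k}[m, m+1)`:
the non-cancellative `h⁰` for `η = false`, the cancellative `h¹` for `η = true`. -/
def haar1D (k : ℤ) (m : ℤ) (η : Bool) (t : ℝ) : ℝ :=
  (Real.sqrt ((2:ℝ) ^ (-k)))⁻¹ *
    (if η then
        (Set.Ico ((2:ℝ) ^ (-k) * m) ((2:ℝ) ^ (-k) * (m + 1/2))).indicator 1 t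
          - (Set.Ico ((2:ℝ) ^ (-k) * (m + 1/2)) ((2:ℝ) ^ (-k) * (m + 1))).indicator 1 t
      else (Set.Ico ((2:ℝ) ^ (-k) * m) ((2:ℝ) ^ (-k) * (m + 1))).indicator 1 t)

/-- The Haar function `h^η_I` for the dyadic cube `I` indexed by `(k, m)`. -/
def haarFn (n : ℕ) (k : ℤ) (m : Fin n → ℤ) (η : Fin n → Bool) (x : Fin n → ℝ) : ℝ :=
  ∏ i, haar1D k (m i) (η i) (x i)

/-- The non-cancellative Haar function `h⁰_I = |I|^{-1/2} 1_I`. -/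
def haarZero (n : ℕ) (k : ℤ) (m : Fin n → ℤ) : (Fin n → ℝ) → ℝ :=
  haarFn n k m (fun _ => false)

/-- The pairing `⟨g, f⟩ = ∫ g f dx`. -/
def pairing {n : ℕ} (g f : (Fin n → ℝ) → ℝ) : ℝ := ∫ x, g x * f x

/-- A normalised standard kernel with Hölder exponent `γ` (with respect to the `ℓ∞` metric). -/
structure IsNormalisedKernel (n : ℕ) (γ : ℝ) (K : (Fin n → ℝ) → (Fin n → ℝ) → ℝ) : Prop where
  size : ∀ x y, x ≠ y → |K x y| ≤ dist x y ^ (-(n:ℝ))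
  smooth : ∀ x y h, 2 * ‖h‖ < dist x y →
    |K (x + h) y - K x y| + |K x (y + h) - K x y| ≤ ‖h‖ ^ γ * dist x y ^ (-(n:ℝ) - γ)

/-- The singular integral `Tf(x) = ∫ K(x,y) f(y) dy`. -/
def czIntegral {n : ℕ} (K : (Fin n → ℝ) → (Fin n → ℝ) → ℝ) (f : (Fin n → ℝ) → ℝ)
    (x : Fin n → ℝ) : ℝ := ∫ y, K x y * f y

/-- The truncated singular integral `T_ε f(x) = ∫_{|y-x|>ε} K(x,y) f(y) dy`. -/
def czTrunc {n : ℕ} (K : (Fin n → ℝ) → (Fin n → ℝ) → ℝ) (ε : ℝ) (f : (Fin n → ℝ) → ℝ)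
    (x : Fin n → ℝ) : ℝ := ∫ y in {y | ε < dist x y}, K x y * f y

/-- The dyadic conditional expectation `E_k f`. -/
def dyadicE (n : ℕ) (k : ℤ) (f : (Fin n → ℝ) → ℝ) (x : Fin n → ℝ) : ℝ :=
  (2:ℝ) ^ (k * (n:ℤ)) * ∫ y in dyadicCube n k (fun i => ⌊(2:ℝ) ^ k * x i⌋), f y

/-- The dyadic martingale difference `D_k f = E_{k+1} f - E_k f`. -/
def dyadicD (n : ℕ) (k : ℤ) (f : (Fin n → ℝ) → ℝ) (x : Fin n → ℝ) : ℝ :=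
  dyadicE n (k+1) f x - dyadicE n k f x

/-- The centre of the dyadic cube indexed by `(k, m)`. -/
def cubeCenter (n : ℕ) (k : ℤ) (m : Fin n → ℤ) : Fin n → ℝ :=
  fun i => (2:ℝ) ^ (-k) * (m i + 1/2)

/-- The concentric `c`-fold expansion of the dyadic cube indexed by `(k, m)`. -/
def expandCube (n : ℕ) (k : ℤ) (m : Fin n → ℤ) (c : ℝ) : Set (Fin n → ℝ) :=
  {x | ∀ i, |x i - cubeCenter n k m i| ≤ c * (2:ℝ) ^ (-k) / 2}

/-- The set `Σ_{f,s} = ⋃_k 9Ω_k`, where `Ω_k` is the union of the cubes `I ∈ 𝒟_k` on which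
`D_{k+s} f` is not a.e. zero. -/
def SigmaSet (n : ℕ) (f : (Fin n → ℝ) → ℝ) (s : ℕ) : Set (Fin n → ℝ) :=
  ⋃ (k : ℤ) (m : Fin n → ℤ)
    (_ : ¬ (∀ᵐ x ∂(volume.restrict (dyadicCube n k m)), dyadicD n (k + (s:ℤ)) f x = 0)),
      expandCube n k m 9

/-- The (measure-theoretic) support of a measurable function: the complement of the union of
all balls on which the function vanishes a.e. -/
def suppAE {n : ℕ} (f : (Fin n → ℝ) → ℝ) : Set (Fin n → ℝ) :=
  {x | ∀ r > 0, ¬ (∀ᵐ y ∂(volume.restrict (Metric.ball x r)), f y = 0)}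

/-- The axis-parallel closed cube with centre `c` and side length `ρ`. -/
def cube (n : ℕ) (c : Fin n → ℝ) (ρ : ℝ) : Set (Fin n → ℝ) :=
  {x | ∀ i, |x i - c i| ≤ ρ / 2}

/-- The index of the `s`-th dyadic ancestor `I^{(s)}` of the cube indexed by `(k, m)`
(the ancestor is the cube indexed by `(k - s, ancestorIdx s m)`). -/
def ancestorIdx {n : ℕ} (s : ℕ) (m : Fin n → ℤ) : Fin n → ℤ :=
  fun i => Int.fdiv (m i) (2 ^ s)

/-- The distance between two sets (in the ambient metric). -/
def setDist {α : Type*} [PseudoMetricSpace α] (A B : Set α) : ℝ :=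
  sInf (Set.image2 dist A B)

/-- The operator `Ψ_s = Σ_k (Id - E_k) T_{4·2^{-k}} D_{k+s}`, as a pointwise sum over `k`. -/
def PsiOp (n : ℕ) (K : (Fin n → ℝ) → (Fin n → ℝ) → ℝ) (s : ℕ)
    (f : (Fin n → ℝ) → ℝ) (x : Fin n → ℝ) : ℝ :=
  ∑' k : ℤ,
    (czTrunc K (4 * (2:ℝ) ^ (-k)) (dyadicD n (k + (s:ℤ)) f) x -
      dyadicE n k (czTrunc K (4 * (2:ℝ) ^ (-k)) (dyadicD n (k + (s:ℤ)) f)) x)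
/-- The operator `Φ̃_s` of (2.9) (sum over all translations `m ∈ ℤ^n`; the term `m = 0`
vanishes), applied to `f`, as a pointwise sum. -/
def PhiTilde (n : ℕ) (K : (Fin n → ℝ) → (Fin n → ℝ) → ℝ) (s : ℕ)
    (f : (Fin n → ℝ) → ℝ) (x : Fin n → ℝ) : ℝ :=
  ∑' m : Fin n → ℤ, ∑ η : Fin n → Bool,
    if η = (fun _ => false) then 0 else
      ∑' (k : ℤ) (mI : Fin n → ℤ),
        (haarZero n (k - s) (ancestorIdx s mI + m) x - haarZero n (k - s) (ancestorIdx s mI) x) *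
          pairing (haarZero n (k - s) (ancestorIdx s mI + m)) (czIntegral K (haarFn n k mI η)) *
          pairing (haarFn n k mI η) f

lemma mem_Ico_dyadic_iff (k m : ℤ) (t : ℝ) :
    t ∈ Set.Ico ((2:ℝ) ^ (-k) * m) ((2:ℝ) ^ (-k) * (m + 1)) ↔ ⌊(2:ℝ) ^ k * t⌋ = m := by
  have h2 : (0:ℝ) < 2 ^ k := by positivity
  rw [Int.floor_eq_iff, Set.mem_Ico, zpow_neg, inv_mul_le_iff₀ h2, lt_inv_mul_iff₀ h2]

lemma mem_dyadicCube_iff {n : ℕ} (k : ℤ) (m : Fin n → ℤ) (x : Fin n → ℝ) :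
    x ∈ dyadicCube n k m ↔ (fun i => ⌊(2:ℝ) ^ k * x i⌋) = m := by
  rw [funext_iff]
  exact forall_congr' fun i => mem_Ico_dyadic_iff k (m i) (x i)

lemma dyadicCube_eq_pi (n : ℕ) (k : ℤ) (m : Fin n → ℤ) :
    dyadicCube n k m =
      Set.univ.pi fun i => Set.Ico ((2:ℝ) ^ (-k) * m i) ((2:ℝ) ^ (-k) * (m i + 1)) := by
  ext x
  simp [dyadicCube, Set.mem_pi]

lemma measurableSet_dyadicCube (n : ℕ) (k : ℤ) (m : Fin n → ℤ) :
    MeasurableSet (dyadicCube n k m) := by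
  rw [dyadicCube_eq_pi]
  exact MeasurableSet.univ_pi fun i => measurableSet_Ico

lemma volume_dyadicCube (n : ℕ) (k : ℤ) (m : Fin n → ℤ) :
    volume (dyadicCube n k m) = ENNReal.ofReal ((2:ℝ) ^ (-k)) ^ n := by
  rw [dyadicCube_eq_pi, volume_pi_pi]
  have (i : Fin n) : (2:ℝ) ^ (-k) * (m i + 1) - 2 ^ (-k) * m i = 2 ^ (-k) := by ring
  simp only [Real.volume_Ico, this]
  simp

lemma floor_zpow_mul_eq_ediv (k : ℤ) (s : ℕ) (t : ℝ) :
    ⌊(2:ℝ) ^ (k - s) * t⌋ = ⌊(2:ℝ) ^ k * t⌋ / (2 ^ s : ℕ) := by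
  rw [← Int.floor_div_natCast]
  congr 1
  rw [zpow_sub₀ two_ne_zero]
  push_cast
  rw [zpow_natCast]
  ring

lemma floor_zpow_mul_congr {j k : ℤ} (hjk : j ≤ k) {t t' : ℝ}
    (h : ⌊(2:ℝ) ^ k * t⌋ = ⌊(2:ℝ) ^ k * t'⌋) : ⌊(2:ℝ) ^ j * t⌋ = ⌊(2:ℝ) ^ j * t'⌋ := by
  obtain ⟨s, hs⟩ := Int.eq_ofNat_of_zero_le (sub_nonneg.2 hjk)
  obtain rfl : j = k - s := by omega
  rw [floor_zpow_mul_eq_ediv, floor_zpow_mul_eq_ediv, h]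

lemma dyadicCube_subset_ancestor {n : ℕ} (k : ℤ) (m : Fin n → ℤ) (s : ℕ) :
    dyadicCube n k m ⊆ dyadicCube n (k - s) (ancestorIdx s m) := by
  intro x hx
  rw [mem_dyadicCube_iff] at hx ⊢
  ext i
  rw [floor_zpow_mul_eq_ediv, ← hx, ancestorIdx, Int.fdiv_eq_ediv_of_nonneg _ (by positivity)]
  norm_num

lemma haar1D_eq_floor (k m : ℤ) (η : Bool) (t : ℝ) :
    haar1D k m η t = (Real.sqrt ((2:ℝ) ^ (-k)))⁻¹ *
      (if η then (if ⌊(2:ℝ) ^ (k + 1) * t⌋ = 2 * m then 1 else 0) -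
          (if ⌊(2:ℝ) ^ (k + 1) * t⌋ = 2 * m + 1 then 1 else 0)
        else if ⌊(2:ℝ) ^ k * t⌋ = m then 1 else 0) := by
  have h2 : (2:ℝ) ^ (-k) = 2 ^ (-(k + 1)) * 2 := by
    rw [← zpow_add_one₀ two_ne_zero]; congr 1; ring
  have e1 : (2:ℝ) ^ (-k) * m = 2 ^ (-(k + 1)) * ((2 * m : ℤ) : ℝ) := by
    rw [h2]; push_cast; ring
  have e2 : (2:ℝ) ^ (-k) * (m + 1 / 2) = 2 ^ (-(k + 1)) * (((2 * m : ℤ) : ℝ) + 1) := by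
    rw [h2]; push_cast; ring
  have e3 : (2:ℝ) ^ (-k) * (m + 1 / 2) = 2 ^ (-(k + 1)) * ((2 * m + 1 : ℤ) : ℝ) := by
    rw [h2]; push_cast; ring
  have e4 : (2:ℝ) ^ (-k) * (m + 1) = 2 ^ (-(k + 1)) * (((2 * m + 1 : ℤ) : ℝ) + 1) := by
    rw [h2]; push_cast; ring
  have f0 := mem_Ico_dyadic_iff k m t
  have f1 := mem_Ico_dyadic_iff (k + 1) (2 * m) t
  have f2 := mem_Ico_dyadic_iff (k + 1) (2 * m + 1) t
  rw [← e1, ← e2] at f1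
  rw [← e3, ← e4] at f2
  cases η <;> simp only [haar1D, Set.indicator_apply, f0, f1, f2, Pi.one_apply]

lemma haar1D_congr {j k : ℤ} (hkj : k < j) (m : ℤ) (η : Bool) {t t' : ℝ}
    (h : ⌊(2:ℝ) ^ j * t⌋ = ⌊(2:ℝ) ^ j * t'⌋) : haar1D k m η t = haar1D k m η t' := by
  rw [haar1D_eq_floor, haar1D_eq_floor, floor_zpow_mul_congr hkj.le h,
    floor_zpow_mul_congr (Int.add_one_le_iff.2 hkj) h]

lemma haar1D_eq_zero {k m : ℤ} (η : Bool) {t : ℝ} (h : ⌊(2:ℝ) ^ k * t⌋ ≠ m) :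
    haar1D k m η t = 0 := by
  have := floor_zpow_mul_eq_ediv (k + 1) 1 t
  simp only [Nat.cast_one, add_sub_cancel_right, pow_one, Nat.cast_ofNat] at this
  have h1 : ⌊(2:ℝ) ^ (k + 1) * t⌋ ≠ 2 * m := by omega
  have h2 : ⌊(2:ℝ) ^ (k + 1) * t⌋ ≠ 2 * m + 1 := by omega
  simp [haar1D_eq_floor, h, h1, h2]

lemma integrable_haar1D (k m : ℤ) (η : Bool) : Integrable (haar1D k m η) := by
  have (a b : ℝ) : Integrable ((Set.Ico a b).indicator (1 : ℝ → ℝ)) :=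
    (integrable_indicator_iff measurableSet_Ico).2 (integrableOn_const (by simp))
  cases η
  · exact (this _ _).const_mul _
  · exact ((this _ _).sub (this _ _)).const_mul _

lemma integral_haar1D_true (k m : ℤ) : ∫ t, haar1D k m true t = 0 := by
  have hi (a b : ℝ) : Integrable ((Set.Ico a b).indicator (1 : ℝ → ℝ)) :=
    (integrable_indicator_iff measurableSet_Ico).2 (integrableOn_const (by simp))
  simp only [haar1D, if_true]
  rw [integral_const_mul, integral_sub (hi _ _) (hi _ _),
    integral_indicator measurableSet_Ico, integral_indicator measurableSet_Ico]
  have h2 : (0:ℝ) < 2 ^ (-k) := by positivity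
  simp only [Pi.one_apply, integral_const, MeasurableSet.univ, measureReal_restrict_apply,
    Set.univ_inter, smul_eq_mul, mul_one]
  rw [Real.volume_real_Ico_of_le (by nlinarith), Real.volume_real_Ico_of_le (by nlinarith)]
  ring

/-- A cancellative Haar function is orthogonal to functions that are constant on its interval. -/
lemma integral_mul_haar1D_true_eq_zero {k m : ℤ} {g : ℝ → ℝ}
    (hg : ∀ t t', ⌊(2:ℝ) ^ k * t⌋ = m → ⌊(2:ℝ) ^ k * t'⌋ = m → g t = g t') :
    ∫ t, g t * haar1D k m true t = 0 := by
  have h2 : (2:ℝ) ^ k ≠ 0 := by positivity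
  have h0 : ⌊(2:ℝ) ^ k * ((2 ^ k)⁻¹ * m)⌋ = m := by
    rw [mul_inv_cancel_left₀ h2, Int.floor_intCast]
  have : (fun t => g t * haar1D k m true t) =
      fun t => g ((2 ^ k)⁻¹ * m) * haar1D k m true t := by
    ext t
    by_cases h : ⌊(2:ℝ) ^ k * t⌋ = m
    · rw [hg t _ h h0]
    · simp [haar1D_eq_zero true h]
  rw [this, integral_const_mul, integral_haar1D_true, mul_zero]

lemma integral_haar1D_mul_self (k m : ℤ) (η : Bool) :
    ∫ t, haar1D k m η t * haar1D k m η t = 1 := by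
  have h2 : (0:ℝ) < 2 ^ (-k) := by positivity
  have : (fun t => haar1D k m η t * haar1D k m η t) =
      (Set.Ico ((2:ℝ) ^ (-k) * m) ((2:ℝ) ^ (-k) * (m + 1))).indicator
        fun _ => ((2:ℝ) ^ (-k))⁻¹ := by
    ext t
    by_cases h : ⌊(2:ℝ) ^ k * t⌋ = m
    · rw [Set.indicator_of_mem ((mem_Ico_dyadic_iff k m t).2 h)]
      have hs : (Real.sqrt ((2:ℝ) ^ (-k)))⁻¹ * (Real.sqrt ((2:ℝ) ^ (-k)))⁻¹ =
          ((2:ℝ) ^ (-k))⁻¹ := by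
        rw [← mul_inv, Real.mul_self_sqrt h2.le]
      have := floor_zpow_mul_eq_ediv (k + 1) 1 t
      simp only [Nat.cast_one, add_sub_cancel_right, pow_one, Nat.cast_ofNat] at this
      have h' : ⌊(2:ℝ) ^ (k + 1) * t⌋ = 2 * m ∨ ⌊(2:ℝ) ^ (k + 1) * t⌋ = 2 * m + 1 := by omega
      rw [haar1D_eq_floor, ← hs, h]
      rcases h' with h' | h' <;> rw [h'] <;> cases η <;> simp
    · rw [haar1D_eq_zero η h, Set.indicator_of_notMem (by rwa [mem_Ico_dyadic_iff]), mul_zero]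
  rw [this, integral_indicator measurableSet_Ico, setIntegral_const,
    Real.volume_real_Ico_of_le (by nlinarith), smul_eq_mul]
  field_simp
  ring

lemma haarFn_eq_zero {n : ℕ} {k : ℤ} {m : Fin n → ℤ} (η : Fin n → Bool) {x : Fin n → ℝ}
    (hx : x ∉ dyadicCube n k m) : haarFn n k m η x = 0 := by
  rw [mem_dyadicCube_iff, funext_iff, not_forall] at hx
  obtain ⟨i, hi⟩ := hx
  exact Finset.prod_eq_zero (Finset.mem_univ i) (haar1D_eq_zero _ hi)

lemma haarFn_congr {n : ℕ} {j k : ℤ} (hkj : k < j) (m : Fin n → ℤ) (η : Fin n → Bool)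
    {x y : Fin n → ℝ} (h : ∀ i, ⌊(2:ℝ) ^ j * x i⌋ = ⌊(2:ℝ) ^ j * y i⌋) :
    haarFn n k m η x = haarFn n k m η y :=
  Finset.prod_congr rfl fun i _ => haar1D_congr hkj (m i) (η i) (h i)

lemma integrable_haarFn (n : ℕ) (k : ℤ) (m : Fin n → ℤ) (η : Fin n → Bool) :
    Integrable (haarFn n k m η) :=
  Integrable.fintype_prod fun i => integrable_haar1D k (m i) (η i)

lemma haarZero_eq_indicator (n : ℕ) (k : ℤ) (m : Fin n → ℤ) :
    haarZero n k m =
      (dyadicCube n k m).indicator fun _ => (Real.sqrt ((2:ℝ) ^ (-k)))⁻¹ ^ n := by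
  ext x
  by_cases hx : x ∈ dyadicCube n k m
  · rw [Set.indicator_of_mem hx]
    rw [mem_dyadicCube_iff, funext_iff] at hx
    simp [haarZero, haarFn, haar1D_eq_floor, hx]
  · rw [Set.indicator_of_notMem hx]
    exact haarFn_eq_zero _ hx

lemma exists_eq_true_of_ne_false {n : ℕ} {η : Fin n → Bool} (hη : η ≠ fun _ => false) :
    ∃ i, η i = true := by
  contrapose! hη
  ext i
  simpa using hη i

/-- Averaging a Haar function over a cube that is not strictly smaller gives zero. -/
lemma setIntegral_haarFn_eq_zero {n : ℕ} {j k : ℤ} (hjk : j ≤ k) (M m : Fin n → ℤ)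
    {η : Fin n → Bool} (hη : η ≠ fun _ => false) :
    ∫ y in dyadicCube n j M, haarFn n k m η y = 0 := by
  obtain ⟨i₀, hi₀⟩ := exists_eq_true_of_ne_false hη
  rw [← integral_indicator (measurableSet_dyadicCube n j M)]
  have : (dyadicCube n j M).indicator (haarFn n k m η) = fun y : Fin n → ℝ =>
      ∏ i, (if ⌊(2:ℝ) ^ j * y i⌋ = M i then 1 else 0) * haar1D k (m i) (η i) (y i) := by
    classical
    ext y
    simp only [Set.indicator_apply, mem_dyadicCube_iff, funext_iff, Fintype.prod_ite_zero,
      ite_mul, one_mul, zero_mul, haarFn]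
    congr
  rw [this, integral_fintype_prod_volume_eq_prod
    (f := fun i t => (if ⌊(2:ℝ) ^ j * t⌋ = M i then 1 else 0) * haar1D k (m i) (η i) t)]
  refine Finset.prod_eq_zero (Finset.mem_univ i₀) ?_
  simp only [hi₀]
  refine integral_mul_haar1D_true_eq_zero fun t t' ht ht' => ?_
  rw [floor_zpow_mul_congr hjk (ht.trans ht'.symm)]

lemma dyadicE_haarFn {n : ℕ} (j k : ℤ) (m : Fin n → ℤ) {η : Fin n → Bool}
    (hη : η ≠ fun _ => false) (x : Fin n → ℝ) :
    dyadicE n j (haarFn n k m η) x = if k < j then haarFn n k m η x else 0 := by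
  unfold dyadicE
  split_ifs with h
  · have hc : ∀ y ∈ dyadicCube n j (fun i => ⌊(2:ℝ) ^ j * x i⌋),
        haarFn n k m η y = haarFn n k m η x := by
      intro y hy
      rw [mem_dyadicCube_iff, funext_iff] at hy
      exact haarFn_congr h m η hy
    rw [setIntegral_congr_fun (measurableSet_dyadicCube n j _) hc, setIntegral_const,
      measureReal_def, volume_dyadicCube, ENNReal.toReal_pow,
      ENNReal.toReal_ofReal (by positivity), smul_eq_mul, ← mul_assoc, zpow_mul, zpow_natCast,
      ← mul_pow, ← zpow_add₀ two_ne_zero]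
    simp
  · rw [setIntegral_haarFn_eq_zero (not_lt.1 h) _ m hη, mul_zero]

lemma dyadicE_sum {n : ℕ} {ι : Type*} (F : Finset ι) (c : ι → ℝ) (g : ι → (Fin n → ℝ) → ℝ)
    (j : ℤ) (x : Fin n → ℝ)
    (hg : ∀ q ∈ F, IntegrableOn (g q) (dyadicCube n j fun i => ⌊(2:ℝ) ^ j * x i⌋)) :
    dyadicE n j (fun y => ∑ q ∈ F, c q * g q y) x = ∑ q ∈ F, c q * dyadicE n j (g q) x := by
  unfold dyadicE
  rw [integral_finsetSum _ fun q hq => (hg q hq).const_mul (c q), Finset.mul_sum]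
  refine Finset.sum_congr rfl fun q _ => ?_
  rw [integral_const_mul]
  ring

lemma pairing_haarFn_self (n : ℕ) (k : ℤ) (m : Fin n → ℤ) (η : Fin n → Bool) :
    pairing (haarFn n k m η) (haarFn n k m η) = 1 := by
  unfold pairing haarFn
  simp only [← Finset.prod_mul_distrib]
  rw [integral_fintype_prod_volume_eq_prod
    (f := fun i t => haar1D k (m i) (η i) t * haar1D k (m i) (η i) t)]
  simp [integral_haar1D_mul_self]

lemma pairing_comm {n : ℕ} (f g : (Fin n → ℝ) → ℝ) : pairing f g = pairing g f := by
  simp only [pairing, mul_comm]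

lemma pairing_haarFn_of_integral_eq_zero {n : ℕ} {k k' : ℤ} {m m' : Fin n → ℤ}
    {η η' : Fin n → Bool} (i : Fin n)
    (h : ∫ t, haar1D k (m i) (η i) t * haar1D k' (m' i) (η' i) t = 0) :
    pairing (haarFn n k m η) (haarFn n k' m' η') = 0 := by
  unfold pairing haarFn
  simp only [← Finset.prod_mul_distrib]
  rw [integral_fintype_prod_volume_eq_prod
    (f := fun i t => haar1D k (m i) (η i) t * haar1D k' (m' i) (η' i) t)]
  exact Finset.prod_eq_zero (Finset.mem_univ i) h

lemma pairing_haarFn_of_lt {n : ℕ} {k k' : ℤ} (hk : k < k') (m m' : Fin n → ℤ)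
    (η : Fin n → Bool) {η' : Fin n → Bool} (hη' : η' ≠ fun _ => false) :
    pairing (haarFn n k m η) (haarFn n k' m' η') = 0 := by
  obtain ⟨i, hi⟩ := exists_eq_true_of_ne_false hη'
  refine pairing_haarFn_of_integral_eq_zero i ?_
  rw [hi]
  exact integral_mul_haar1D_true_eq_zero fun t t' ht ht' =>
    haar1D_congr hk _ _ (ht.trans ht'.symm)

lemma integral_haar1D_false_mul_true (k m : ℤ) :
    ∫ t, haar1D k m false t * haar1D k m true t = 0 :=
  integral_mul_haar1D_true_eq_zero fun t t' ht ht' => by simp [haar1D_eq_floor, ht, ht']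

/-- The cancellative Haar functions form an orthonormal system. -/
lemma pairing_haarFn {n : ℕ} {q q' : ℤ × (Fin n → ℤ) × (Fin n → Bool)}
    (hq : q.2.2 ≠ fun _ => false) (hq' : q'.2.2 ≠ fun _ => false) :
    pairing (haarFn n q.1 q.2.1 q.2.2) (haarFn n q'.1 q'.2.1 q'.2.2) =
      if q = q' then 1 else 0 := by
  obtain ⟨k, m, η⟩ := q
  obtain ⟨k', m', η'⟩ := q'
  dsimp only at *
  rcases lt_trichotomy k k' with hk | rfl | hk
  · rw [pairing_haarFn_of_lt hk m m' η hq', if_neg fun h => hk.ne (congrArg Prod.fst h)]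
  · by_cases hm : m = m'
    · subst hm
      by_cases hη : η = η'
      · subst hη
        rw [pairing_haarFn_self, if_pos rfl]
      · rw [if_neg fun h => hη (by simpa using h)]
        obtain ⟨i, hi⟩ := Function.ne_iff.1 hη
        refine pairing_haarFn_of_integral_eq_zero i ?_
        revert hi
        rcases η i <;> rcases η' i <;> intro hi <;> try exact absurd rfl hi
        · exact integral_haar1D_false_mul_true _ _
        · simp_rw [mul_comm (haar1D k (m i) true _)]
          exact integral_haar1D_false_mul_true _ _
    · rw [if_neg fun h => hm (congrArg (fun q => q.2.1) h)]
      obtain ⟨i, hi⟩ := Function.ne_iff.1 hm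
      refine pairing_haarFn_of_integral_eq_zero i ?_
      rw [← integral_zero ℝ ℝ]
      congr 1
      ext t
      by_cases ht : ⌊(2:ℝ) ^ k * t⌋ = m i
      · rw [haar1D_eq_zero (m := m' i) _ (by rwa [ht]), mul_zero]
      · rw [haar1D_eq_zero _ ht, zero_mul]
  · rw [pairing_comm, pairing_haarFn_of_lt hk m' m η' hq,
      if_neg fun h => hk.ne' (congrArg Prod.fst h)]

lemma integrable_haarFn_mul (n : ℕ) (k k' : ℤ) (m m' : Fin n → ℤ) (η η' : Fin n → Bool) :
    Integrable fun x => haarFn n k m η x * haarFn n k' m' η' x := by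
  unfold haarFn
  simp only [← Finset.prod_mul_distrib]
  refine Integrable.fintype_prod
    (f := fun i t => haar1D k (m i) (η i) t * haar1D k' (m' i) (η' i) t) fun i => ?_
  refine (integrable_haar1D k' (m' i) (η' i)).bdd_mul
    (c := (Real.sqrt ((2:ℝ) ^ (-k)))⁻¹) (integrable_haar1D k (m i) (η i)).aestronglyMeasurable
    (Filter.Eventually.of_forall fun t => ?_)
  rw [haar1D_eq_floor, Real.norm_eq_abs, abs_mul, abs_of_nonneg (by positivity)]
  refine mul_le_of_le_one_right (by positivity) ?_
  split_ifs <;> first | omega | simp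

lemma pairing_sum {n : ℕ} (F : Finset (ℤ × (Fin n → ℤ) × (Fin n → Bool)))
    (c : ℤ × (Fin n → ℤ) × (Fin n → Bool) → ℝ) (hF : ∀ q ∈ F, q.2.2 ≠ fun _ => false)
    {q : ℤ × (Fin n → ℤ) × (Fin n → Bool)} (hq : q.2.2 ≠ fun _ => false) :
    pairing (haarFn n q.1 q.2.1 q.2.2)
      (fun x => ∑ p ∈ F, c p * haarFn n p.1 p.2.1 p.2.2 x) = if q ∈ F then c q else 0 := by
  have : pairing (haarFn n q.1 q.2.1 q.2.2)
      (fun x => ∑ p ∈ F, c p * haarFn n p.1 p.2.1 p.2.2 x) =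
      ∑ p ∈ F, c p * pairing (haarFn n q.1 q.2.1 q.2.2) (haarFn n p.1 p.2.1 p.2.2) := by
    simp only [pairing, Finset.mul_sum, mul_left_comm _ (c _)]
    rw [integral_finsetSum _ fun p _ => (integrable_haarFn_mul n _ _ _ _ _ _).const_mul (c p)]
    simp only [integral_const_mul]
  rw [this, Finset.sum_congr rfl fun p hp => by rw [pairing_haarFn hq (hF p hp)]]
  simp

lemma dyadicD_sum {n : ℕ} (F : Finset (ℤ × (Fin n → ℤ) × (Fin n → Bool)))
    (c : ℤ × (Fin n → ℤ) × (Fin n → Bool) → ℝ) (hF : ∀ q ∈ F, q.2.2 ≠ fun _ => false) (j : ℤ) :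
    dyadicD n j (fun x => ∑ q ∈ F, c q * haarFn n q.1 q.2.1 q.2.2 x) =
      fun x => ∑ q ∈ F with q.1 = j, c q * haarFn n q.1 q.2.1 q.2.2 x := by
  ext x
  unfold dyadicD
  rw [dyadicE_sum _ _ _ _ _ fun q _ => (integrable_haarFn n _ _ _).integrableOn,
    dyadicE_sum _ _ _ _ _ fun q _ => (integrable_haarFn n _ _ _).integrableOn,
    ← Finset.sum_sub_distrib, Finset.sum_filter]
  refine Finset.sum_congr rfl fun q hq => ?_
  rw [dyadicE_haarFn _ _ _ (hF q hq), dyadicE_haarFn _ _ _ (hF q hq), ← mul_sub]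
  rcases lt_trichotomy q.1 j with h | h | h
  · rw [if_pos (by omega), if_pos h, if_neg h.ne, sub_self, mul_zero]
  · rw [if_pos (by omega), if_neg (by omega), if_pos h, sub_zero]
  · rw [if_neg (by omega), if_neg (by omega), if_neg h.ne', sub_zero, mul_zero]

lemma notMem_expandCube_of_notMem_SigmaSet {n : ℕ}
    {F : Finset (ℤ × (Fin n → ℤ) × (Fin n → Bool))}
    {c : ℤ × (Fin n → ℤ) × (Fin n → Bool) → ℝ} (hF : ∀ q ∈ F, q.2.2 ≠ fun _ => false)
    {s : ℕ} {x : Fin n → ℝ}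
    (hx : x ∉ SigmaSet n (fun x => ∑ q ∈ F, c q * haarFn n q.1 q.2.1 q.2.2 x) s)
    {q : ℤ × (Fin n → ℤ) × (Fin n → Bool)} (hq : q ∈ F) (hcq : c q ≠ 0) :
    x ∉ expandCube n (q.1 - s) (ancestorIdx s q.2.1) 9 := by
  refine fun hmem => hx ?_
  simp only [SigmaSet, Set.mem_iUnion]
  refine ⟨q.1 - s, ancestorIdx s q.2.1, fun hae => hcq ?_, hmem⟩
  rw [sub_add_cancel, dyadicD_sum F c hF] at hae
  have hp := pairing_sum (F.filter fun p => p.1 = q.1) c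
    (fun p hp => hF p (Finset.mem_filter.1 hp).1) (hF q hq)
  rw [if_pos (by simp [hq])] at hp
  rw [← hp, pairing]
  refine integral_eq_zero_of_ae ?_
  filter_upwards [(ae_restrict_iff' (measurableSet_dyadicCube n _ _)).1 hae] with y hy
  by_cases hyq : y ∈ dyadicCube n q.1 q.2.1
  · rw [hy (dyadicCube_subset_ancestor _ _ s hyq), mul_zero, Pi.zero_apply]
  · rw [haarFn_eq_zero _ hyq, zero_mul, Pi.zero_apply]

/-- The dyadic cube of a point outside the ninefold expansion of a cube of the same generation
stays at distance more than four side-lengths from that cube. -/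
lemma lt_dist_of_notMem_expandCube {n : ℕ} {k : ℤ} {m : Fin n → ℤ} {x x' y : Fin n → ℝ}
    (hx : x ∉ expandCube n k m 9) (hx' : x' ∈ dyadicCube n k fun i => ⌊(2:ℝ) ^ k * x i⌋)
    (hy : y ∈ dyadicCube n k m) : 4 * (2:ℝ) ^ (-k) < dist x' y := by
  simp only [expandCube, Set.mem_ofPred_eq, not_forall, not_le, cubeCenter] at hx
  obtain ⟨i, hi⟩ := hx
  refine lt_of_lt_of_le ?_ (dist_le_pi_dist x' y i)
  have hxi : x i ∈ Set.Ico ((2:ℝ) ^ (-k) * ⌊(2:ℝ) ^ k * x i⌋)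
      ((2:ℝ) ^ (-k) * (⌊(2:ℝ) ^ k * x i⌋ + 1)) := (mem_Ico_dyadic_iff k _ _).2 rfl
  have hx'i := hx' i
  have hyi := hy i
  have h2 : (0:ℝ) < 2 ^ (-k) := by positivity
  set l : ℝ := 2 ^ (-k)
  dsimp only at hx'i
  set M := ⌊(2:ℝ) ^ k * x i⌋
  rw [Real.dist_eq]
  rcases lt_abs.1 hi with h | h
  · have : (m i : ℝ) + 4 < M := by
      have := hxi.2
      nlinarith
    have : m i + 5 ≤ M := by
      have : m i + 4 < M := by exact_mod_cast this
      omega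
    have : (m i : ℝ) + 5 ≤ M := by exact_mod_cast this
    refine lt_of_lt_of_le ?_ (le_abs_self _)
    nlinarith [hx'i.1, hyi.2]
  · have : (M : ℝ) < m i - 4 := by
      have := hxi.1
      nlinarith
    have : M ≤ m i - 5 := by
      have : M < m i - 4 := by exact_mod_cast this
      omega
    have : (M : ℝ) ≤ m i - 5 := by exact_mod_cast this
    refine lt_of_lt_of_le ?_ (neg_le_abs _)
    nlinarith [hx'i.2, hyi.1]

lemma mem_dyadicCube_floor {n : ℕ} (k : ℤ) (x : Fin n → ℝ) :
    x ∈ dyadicCube n k fun i => ⌊(2:ℝ) ^ k * x i⌋ :=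
  (mem_dyadicCube_iff k _ x).2 rfl

lemma dyadicCube_subset_expandCube {n : ℕ} (k : ℤ) (m : Fin n → ℤ) :
    dyadicCube n k m ⊆ expandCube n k m 9 := by
  intro x hx i
  have h2 : (0:ℝ) < 2 ^ (-k) := by positivity
  rw [cubeCenter, abs_le]
  constructor <;> nlinarith [hx i]

namespace IsNormalisedKernel

variable {n : ℕ} {γ : ℝ} {K : (Fin n → ℝ) → (Fin n → ℝ) → ℝ}

lemma tendsto_rpow_norm_sub_mul (hγ : 0 < γ) (x : Fin n → ℝ) (C : ℝ) :
    Filter.Tendsto (fun z => ‖z - x‖ ^ γ * C) (nhds x) (nhds 0) := by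
  have : Continuous fun z : Fin n → ℝ => ‖z - x‖ ^ γ * C :=
    ((continuous_id.sub continuous_const).norm.rpow_const fun _ => Or.inr hγ.le).mul_const C
  simpa [Real.zero_rpow hγ.ne'] using this.tendsto x

lemma eventually_two_mul_norm_sub_lt {x y : Fin n → ℝ} (hxy : x ≠ y) (a : Fin n → ℝ) :
    ∀ᶠ z in nhds a, 2 * ‖z - a‖ < dist x y := by
  have : Continuous fun z : Fin n → ℝ => 2 * ‖z - a‖ := by fun_prop
  refine this.tendsto a |>.eventually_lt_const ?_
  simpa using hxy

lemma continuousAt_left (hK : IsNormalisedKernel n γ K) (hγ : 0 < γ) {x y : Fin n → ℝ}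
    (hxy : x ≠ y) : ContinuousAt (fun z => K z y) x := by
  rw [ContinuousAt, tendsto_iff_norm_sub_tendsto_zero]
  refine squeeze_zero' (Filter.Eventually.of_forall fun _ => norm_nonneg _) ?_
    (tendsto_rpow_norm_sub_mul hγ x (dist x y ^ (-(n:ℝ) - γ)))
  filter_upwards [eventually_two_mul_norm_sub_lt hxy x] with z hz
  have := hK.smooth x y (z - x) hz
  rw [add_sub_cancel] at this
  exact (le_add_of_nonneg_right (abs_nonneg _)).trans this

lemma continuousAt_right (hK : IsNormalisedKernel n γ K) (hγ : 0 < γ) {x y : Fin n → ℝ}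
    (hxy : x ≠ y) : ContinuousAt (fun z => K x z) y := by
  rw [ContinuousAt, tendsto_iff_norm_sub_tendsto_zero]
  refine squeeze_zero' (Filter.Eventually.of_forall fun _ => norm_nonneg _) ?_
    (tendsto_rpow_norm_sub_mul hγ y (dist x y ^ (-(n:ℝ) - γ)))
  filter_upwards [eventually_two_mul_norm_sub_lt hxy y] with z hz
  have := hK.smooth x y (z - y) hz
  rw [add_sub_cancel y z] at this
  exact (le_add_of_nonneg_left (abs_nonneg _)).trans this

lemma abs_le_of_lt_dist (hK : IsNormalisedKernel n γ K) {r : ℝ} (hr : 0 < r)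
    {x y : Fin n → ℝ} (h : r < dist x y) : |K x y| ≤ r ^ (-(n:ℝ)) :=
  (hK.size x y (dist_pos.1 (hr.trans h))).trans
    (Real.rpow_le_rpow_of_nonpos hr h.le (by simp))

variable {g : (Fin n → ℝ) → ℝ} {A Q : Set (Fin n → ℝ)} {r : ℝ}

lemma norm_mul_le (hK : IsNormalisedKernel n γ K) (hgA : ∀ y ∉ A, g y = 0) (hr : 0 < r)
    {x : Fin n → ℝ} (hx : ∀ y ∈ A, r < dist x y) (y : Fin n → ℝ) :
    ‖K x y * g y‖ ≤ r ^ (-(n:ℝ)) * ‖g y‖ := by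
  by_cases hy : y ∈ A
  · rw [norm_mul]
    exact mul_le_mul_of_nonneg_right (hK.abs_le_of_lt_dist hr (hx y hy)) (norm_nonneg _)
  · simp [hgA y hy]

lemma integrable_mul (hK : IsNormalisedKernel n γ K) (hγ : 0 < γ) (hg : Integrable g)
    (hA : MeasurableSet A) (hgA : ∀ y ∉ A, g y = 0) (hr : 0 < r) {x : Fin n → ℝ}
    (hx : ∀ y ∈ A, r < dist x y) : Integrable fun y => K x y * g y := by
  have hs : Function.support (fun y => K x y * g y) ⊆ A := by
    intro y hy
    by_contra h
    exact hy (by simp [hgA y h])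
  refine (hg.norm.const_mul (r ^ (-(n:ℝ)))).mono' ?_
    (Filter.Eventually.of_forall (hK.norm_mul_le hgA hr hx))
  have hKA : ContinuousOn (fun y => K x y) A := fun y hy =>
    (hK.continuousAt_right hγ (dist_pos.1 (hr.trans (hx y hy)))).continuousWithinAt
  have := (hKA.aestronglyMeasurable hA (μ := volume)).mul hg.aestronglyMeasurable.restrict
  rw [← Set.indicator_eq_self.2 hs]
  exact (aestronglyMeasurable_indicator_iff hA).2 this

lemma continuousOn_czIntegral (hK : IsNormalisedKernel n γ K) (hγ : 0 < γ) (hg : Integrable g)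
    (hA : MeasurableSet A) (hgA : ∀ y ∉ A, g y = 0) (hr : 0 < r)
    (hQ : ∀ x ∈ Q, ∀ y ∈ A, r < dist x y) : ContinuousOn (czIntegral K g) Q := by
  refine continuousOn_of_dominated (bound := fun y => r ^ (-(n:ℝ)) * ‖g y‖)
    (fun x hx => (hK.integrable_mul hγ hg hA hgA hr (hQ x hx)).aestronglyMeasurable)
    (fun x hx => Filter.Eventually.of_forall (hK.norm_mul_le hgA hr (hQ x hx)))
    (hg.norm.const_mul _) (Filter.Eventually.of_forall fun y x hx => ?_)
  by_cases hy : y ∈ A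
  · exact ((hK.continuousAt_left hγ
      (dist_pos.1 (hr.trans (hQ x hx y hy)))).mul continuousAt_const).continuousWithinAt
  · simp only [hgA y hy, mul_zero]
    exact continuousWithinAt_const

lemma integrableOn_czIntegral (hK : IsNormalisedKernel n γ K) (hγ : 0 < γ) (hg : Integrable g)
    (hA : MeasurableSet A) (hgA : ∀ y ∉ A, g y = 0) (hr : 0 < r) (hQm : MeasurableSet Q)
    (hQv : volume Q ≠ ⊤) (hQ : ∀ x ∈ Q, ∀ y ∈ A, r < dist x y) :
    IntegrableOn (czIntegral K g) Q := by
  have : IsFiniteMeasure (volume.restrict Q) := ⟨by simpa using hQv.lt_top⟩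
  refine Integrable.of_bound
    ((hK.continuousOn_czIntegral hγ hg hA hgA hr hQ).aestronglyMeasurable hQm)
    (∫ y, r ^ (-(n:ℝ)) * ‖g y‖) ?_
  filter_upwards [ae_restrict_mem hQm] with x hx
  exact norm_integral_le_of_norm_le (hg.norm.const_mul _)
    (Filter.Eventually.of_forall (hK.norm_mul_le hgA hr (hQ x hx)))

end IsNormalisedKernel

lemma czIntegral_sum {n : ℕ} {ι : Type*} {K : (Fin n → ℝ) → (Fin n → ℝ) → ℝ} (F : Finset ι)
    (c : ι → ℝ) (g : ι → (Fin n → ℝ) → ℝ) {x : Fin n → ℝ}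
    (hg : ∀ q ∈ F, Integrable fun y => K x y * g q y) :
    czIntegral K (fun y => ∑ q ∈ F, c q * g q y) x = ∑ q ∈ F, c q * czIntegral K (g q) x := by
  simp only [czIntegral, Finset.mul_sum, mul_left_comm _ (c _)]
  rw [integral_finsetSum _ fun q hq => (hg q hq).const_mul (c q)]
  simp only [integral_const_mul]

lemma czTrunc_eq_czIntegral {n : ℕ} {K : (Fin n → ℝ) → (Fin n → ℝ) → ℝ}
    {g : (Fin n → ℝ) → ℝ} {r : ℝ} {x : Fin n → ℝ} (h : ∀ y, g y ≠ 0 → r < dist x y) :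
    czTrunc K r g x = czIntegral K g x := by
  refine setIntegral_eq_integral_of_forall_compl_eq_zero fun y hy => ?_
  by_cases hgy : g y = 0
  · rw [hgy, mul_zero]
  · exact absurd (h y hgy) hy

lemma haarZero_mul_pairing {n : ℕ} (k : ℤ) (g : (Fin n → ℝ) → ℝ) (x : Fin n → ℝ) :
    haarZero n k (fun i => ⌊(2:ℝ) ^ k * x i⌋) x *
      pairing (haarZero n k fun i => ⌊(2:ℝ) ^ k * x i⌋) g = dyadicE n k g x := by
  have h2 : (0:ℝ) < 2 ^ (-k) := by positivity
  have hs : (Real.sqrt ((2:ℝ) ^ (-k)))⁻¹ * (Real.sqrt ((2:ℝ) ^ (-k)))⁻¹ = (2:ℝ) ^ k := by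
    rw [← mul_inv, Real.mul_self_sqrt h2.le, zpow_neg, inv_inv]
  have hi (M : Fin n → ℤ) (a : ℝ) : (fun y => (dyadicCube n k M).indicator (fun _ => a) y * g y) =
      (dyadicCube n k M).indicator fun y => a * g y := by
    ext y
    rw [← Set.indicator_mul_left]
  rw [haarZero_eq_indicator, Set.indicator_of_mem (mem_dyadicCube_floor k x), pairing, hi,
    integral_indicator (measurableSet_dyadicCube n k _), integral_const_mul, ← mul_assoc,
    ← mul_pow, hs, dyadicE, zpow_mul, zpow_natCast]

lemma tsum_sum_ite_eq {ι β : Type*} [DecidableEq β] (F : Finset ι) (b : ι → β) (a : ι → ℝ) :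
    (∑' m, ∑ q ∈ F, if m = b q then a q else 0) = ∑ q ∈ F, a q := by
  rw [Summable.tsum_finsetSum fun q _ => (hasSum_ite_eq (b q) (a q)).summable]
  simp only [tsum_ite_eq]

lemma sum_tsum_tsum_eq_sum {n : ℕ} {F : Finset (ℤ × (Fin n → ℤ) × (Fin n → Bool))}
    (hF : ∀ q ∈ F, q.2.2 ≠ fun _ => false) (V : ℤ × (Fin n → ℤ) × (Fin n → Bool) → ℝ) :
    (∑ η : Fin n → Bool, if η = (fun _ => false) then 0 else
      ∑' (k : ℤ) (m : Fin n → ℤ), if (k, m, η) ∈ F then V (k, m, η) else 0) =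
      ∑ q ∈ F, V q := by
  have h1 (k : ℤ) (m : Fin n → ℤ) (η : Fin n → Bool) :
      (if (k, m, η) ∈ F then V (k, m, η) else 0) =
        ∑ q ∈ F, if m = q.2.1 then if k = q.1 then if η = q.2.2 then V q else 0 else 0 else 0 := by
    rw [← Finset.sum_ite_eq F (k, m, η) V]
    refine Finset.sum_congr rfl fun q _ => ?_
    obtain ⟨k', m', η'⟩ := q
    simp only [Prod.mk.injEq, ← ite_and]
    exact if_congr (by tauto) rfl rfl
  have h2 (k : ℤ) (η : Fin n → Bool) :
      (∑' m : Fin n → ℤ, if (k, m, η) ∈ F then V (k, m, η) else 0) =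
        ∑ q ∈ F, if k = q.1 then if η = q.2.2 then V q else 0 else 0 := by
    simp only [h1]
    exact tsum_sum_ite_eq F (fun q => q.2.1) _
  have h3 (η : Fin n → Bool) :
      (∑' (k : ℤ) (m : Fin n → ℤ), if (k, m, η) ∈ F then V (k, m, η) else 0) =
        ∑ q ∈ F, if η = q.2.2 then V q else 0 := by
    simp only [h2]
    exact tsum_sum_ite_eq F (fun q => q.1) _
  have h4 (η : Fin n → Bool) : (if η = (fun _ => false) then 0 else
      ∑' (k : ℤ) (m : Fin n → ℤ), if (k, m, η) ∈ F then V (k, m, η) else 0) =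
      ∑ q ∈ F, if η = q.2.2 then V q else 0 := by
    rw [h3]
    split_ifs with h
    · exact (Finset.sum_eq_zero fun q hq => if_neg fun h' => hF q hq (h'.symm.trans h)).symm
    · rfl
  simp only [h4]
  rw [Finset.sum_comm]
  simp

section OffSigma

variable {n s : ℕ} {γ : ℝ} {K : (Fin n → ℝ) → (Fin n → ℝ) → ℝ}
  {F : Finset (ℤ × (Fin n → ℤ) × (Fin n → Bool))}
  {c : ℤ × (Fin n → ℤ) × (Fin n → Bool) → ℝ} {x : Fin n → ℝ}

lemma lt_dist_of_notMem_SigmaSet (hF : ∀ q ∈ F, q.2.2 ≠ fun _ => false)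
    (hc : ∀ q ∈ F, c q ≠ 0)
    (hx : x ∉ SigmaSet n (fun x => ∑ q ∈ F, c q * haarFn n q.1 q.2.1 q.2.2 x) s)
    {q : ℤ × (Fin n → ℤ) × (Fin n → Bool)} (hq : q ∈ F) {x' y : Fin n → ℝ}
    (hx' : x' ∈ dyadicCube n (q.1 - s) fun i => ⌊(2:ℝ) ^ (q.1 - s) * x i⌋)
    (hy : y ∈ dyadicCube n q.1 q.2.1) : 4 * (2:ℝ) ^ (-(q.1 - s)) < dist x' y :=
  lt_dist_of_notMem_expandCube (notMem_expandCube_of_notMem_SigmaSet hF hx hq (hc q hq)) hx'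
    (dyadicCube_subset_ancestor _ _ s hy)

lemma integrable_kernel_mul_haarFn (hK : IsNormalisedKernel n γ K) (hγ : 0 < γ)
    (hF : ∀ q ∈ F, q.2.2 ≠ fun _ => false) (hc : ∀ q ∈ F, c q ≠ 0)
    (hx : x ∉ SigmaSet n (fun x => ∑ q ∈ F, c q * haarFn n q.1 q.2.1 q.2.2 x) s)
    {q : ℤ × (Fin n → ℤ) × (Fin n → Bool)} (hq : q ∈ F) {x' : Fin n → ℝ}
    (hx' : x' ∈ dyadicCube n (q.1 - s) fun i => ⌊(2:ℝ) ^ (q.1 - s) * x i⌋) :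
    Integrable fun y => K x' y * haarFn n q.1 q.2.1 q.2.2 y :=
  hK.integrable_mul hγ (integrable_haarFn n _ _ _) (measurableSet_dyadicCube n q.1 q.2.1)
    (fun _ hy => haarFn_eq_zero _ hy) (by positivity)
    fun _ hy => lt_dist_of_notMem_SigmaSet hF hc hx hq hx' hy

lemma PhiTilde_eq_sum (hF : ∀ q ∈ F, q.2.2 ≠ fun _ => false) (hc : ∀ q ∈ F, c q ≠ 0)
    (hx : x ∉ SigmaSet n (fun x => ∑ q ∈ F, c q * haarFn n q.1 q.2.1 q.2.2 x) s) :
    PhiTilde n K s (fun x => ∑ q ∈ F, c q * haarFn n q.1 q.2.1 q.2.2 x) x =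
      ∑ q ∈ F, c q * dyadicE n (q.1 - s) (czIntegral K (haarFn n q.1 q.2.1 q.2.2)) x := by
  have h1 (m : Fin n → ℤ) := sum_tsum_tsum_eq_sum hF fun q =>
    (haarZero n (q.1 - s) (ancestorIdx s q.2.1 + m) x -
      haarZero n (q.1 - s) (ancestorIdx s q.2.1) x) *
    pairing (haarZero n (q.1 - s) (ancestorIdx s q.2.1 + m))
      (czIntegral K (haarFn n q.1 q.2.1 q.2.2)) * c q
  have h2 (m : Fin n → ℤ) (η : Fin n → Bool) : (if η = (fun _ => false) then 0 else
      ∑' (k : ℤ) (mI : Fin n → ℤ),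
        (haarZero n (k - s) (ancestorIdx s mI + m) x - haarZero n (k - s) (ancestorIdx s mI) x) *
          pairing (haarZero n (k - s) (ancestorIdx s mI + m)) (czIntegral K (haarFn n k mI η)) *
          pairing (haarFn n k mI η) (fun x => ∑ q ∈ F, c q * haarFn n q.1 q.2.1 q.2.2 x)) =
      if η = (fun _ => false) then 0 else
      ∑' (k : ℤ) (mI : Fin n → ℤ), if (k, mI, η) ∈ F then
        (haarZero n (k - s) (ancestorIdx s mI + m) x - haarZero n (k - s) (ancestorIdx s mI) x) *
          pairing (haarZero n (k - s) (ancestorIdx s mI + m)) (czIntegral K (haarFn n k mI η)) *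
          c (k, mI, η) else 0 := by
    split_ifs with hη
    · rfl
    · refine tsum_congr fun k => tsum_congr fun mI => ?_
      rw [pairing_sum F c hF (q := (k, mI, η)) hη, mul_ite, mul_zero]
  have h3 (m : Fin n → ℤ) (q : ℤ × (Fin n → ℤ) × (Fin n → Bool)) (hq : q ∈ F) :
      (haarZero n (q.1 - s) (ancestorIdx s q.2.1 + m) x -
        haarZero n (q.1 - s) (ancestorIdx s q.2.1) x) *
      pairing (haarZero n (q.1 - s) (ancestorIdx s q.2.1 + m))
        (czIntegral K (haarFn n q.1 q.2.1 q.2.2)) * c q =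
      if m = (fun i => ⌊(2:ℝ) ^ (q.1 - s) * x i⌋) - ancestorIdx s q.2.1 then
        c q * dyadicE n (q.1 - s) (czIntegral K (haarFn n q.1 q.2.1 q.2.2)) x else 0 := by
    have h0 : haarZero n (q.1 - s) (ancestorIdx s q.2.1) x = 0 :=
      haarFn_eq_zero _ fun h => notMem_expandCube_of_notMem_SigmaSet hF hx hq (hc q hq)
        (dyadicCube_subset_expandCube _ _ h)
    rw [h0, sub_zero]
    split_ifs with hm
    · rw [hm, add_sub_cancel, haarZero_mul_pairing, mul_comm]
    · have : haarZero n (q.1 - s) (ancestorIdx s q.2.1 + m) x = 0 :=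
        haarFn_eq_zero _ fun h => hm (by rw [(mem_dyadicCube_iff _ _ _).1 h, add_sub_cancel_left])
      rw [this, zero_mul, zero_mul]
  unfold PhiTilde
  simp only [h2, h1]
  rw [tsum_congr fun m => Finset.sum_congr rfl (h3 m)]
  exact tsum_sum_ite_eq F _ _

lemma czTrunc_dyadicD_eq_sum (hK : IsNormalisedKernel n γ K) (hγ : 0 < γ)
    (hF : ∀ q ∈ F, q.2.2 ≠ fun _ => false) (hc : ∀ q ∈ F, c q ≠ 0)
    (hx : x ∉ SigmaSet n (fun x => ∑ q ∈ F, c q * haarFn n q.1 q.2.1 q.2.2 x) s) (k : ℤ)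
    {x' : Fin n → ℝ} (hx' : x' ∈ dyadicCube n k fun i => ⌊(2:ℝ) ^ k * x i⌋) :
    czTrunc K (4 * (2:ℝ) ^ (-k)) (dyadicD n (k + (s:ℤ))
        (fun x => ∑ q ∈ F, c q * haarFn n q.1 q.2.1 q.2.2 x)) x' =
      ∑ q ∈ F with q.1 = k + s, c q * czIntegral K (haarFn n q.1 q.2.1 q.2.2) x' := by
  rw [dyadicD_sum F c hF, czTrunc_eq_czIntegral, czIntegral_sum]
  · intro q hq
    obtain ⟨hqF, hqk⟩ := Finset.mem_filter.1 hq
    obtain rfl : k = q.1 - s := by omega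
    exact integrable_kernel_mul_haarFn hK hγ hF hc hx hqF hx'
  · intro y hy
    obtain ⟨q, hq, hqy⟩ := Finset.exists_ne_zero_of_sum_ne_zero hy
    obtain ⟨hqF, hqk⟩ := Finset.mem_filter.1 hq
    obtain rfl : k = q.1 - s := by omega
    refine lt_dist_of_notMem_SigmaSet hF hc hx hqF hx' ?_
    by_contra h
    exact hqy (by rw [haarFn_eq_zero _ h, mul_zero])

lemma PsiOp_eq_sum (hK : IsNormalisedKernel n γ K) (hγ : 0 < γ)
    (hF : ∀ q ∈ F, q.2.2 ≠ fun _ => false) (hc : ∀ q ∈ F, c q ≠ 0)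
    (hx : x ∉ SigmaSet n (fun x => ∑ q ∈ F, c q * haarFn n q.1 q.2.1 q.2.2 x) s) :
    PsiOp n K s (fun x => ∑ q ∈ F, c q * haarFn n q.1 q.2.1 q.2.2 x) x =
      ∑ q ∈ F, c q * (czIntegral K (haarFn n q.1 q.2.1 q.2.2) x -
        dyadicE n (q.1 - s) (czIntegral K (haarFn n q.1 q.2.1 q.2.2)) x) := by
  have h1 (k : ℤ) : dyadicE n k (czTrunc K (4 * (2:ℝ) ^ (-k)) (dyadicD n (k + (s:ℤ))
        (fun x => ∑ q ∈ F, c q * haarFn n q.1 q.2.1 q.2.2 x))) x =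
      ∑ q ∈ F with q.1 = k + s, c q * dyadicE n k (czIntegral K (haarFn n q.1 q.2.1 q.2.2)) x := by
    rw [← dyadicE_sum]
    · unfold dyadicE
      rw [setIntegral_congr_fun (measurableSet_dyadicCube n k _) fun x' hx' =>
        czTrunc_dyadicD_eq_sum hK hγ hF hc hx k hx']
    · intro q hq
      obtain ⟨hqF, hqk⟩ := Finset.mem_filter.1 hq
      obtain rfl : k = q.1 - s := by omega
      refine hK.integrableOn_czIntegral (r := 4 * (2:ℝ) ^ (-(q.1 - s))) hγ
        (integrable_haarFn n _ _ _) (measurableSet_dyadicCube n q.1 q.2.1)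
        (fun _ hy => haarFn_eq_zero _ hy) (by positivity) (measurableSet_dyadicCube n _ _) ?_
        fun x' hx' y hy => lt_dist_of_notMem_SigmaSet hF hc hx hqF hx' hy
      rw [volume_dyadicCube]
      exact ENNReal.pow_ne_top ENNReal.ofReal_ne_top
  have h2 (k : ℤ) : czTrunc K (4 * (2:ℝ) ^ (-k)) (dyadicD n (k + (s:ℤ))
        (fun x => ∑ q ∈ F, c q * haarFn n q.1 q.2.1 q.2.2 x)) x -
      dyadicE n k (czTrunc K (4 * (2:ℝ) ^ (-k)) (dyadicD n (k + (s:ℤ))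
        (fun x => ∑ q ∈ F, c q * haarFn n q.1 q.2.1 q.2.2 x))) x =
      ∑ q ∈ F, if k = q.1 - s then c q * (czIntegral K (haarFn n q.1 q.2.1 q.2.2) x -
        dyadicE n (q.1 - s) (czIntegral K (haarFn n q.1 q.2.1 q.2.2)) x) else 0 := by
    rw [h1, czTrunc_dyadicD_eq_sum hK hγ hF hc hx k (mem_dyadicCube_floor k x),
      ← Finset.sum_sub_distrib, Finset.sum_filter]
    refine Finset.sum_congr rfl fun q _ => ?_
    by_cases h : k = q.1 - s
    · rw [if_pos (by omega), if_pos h, ← mul_sub, h]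
    · rw [if_neg (by omega), if_neg h]
  unfold PsiOp
  simp only [h2]
  exact tsum_sum_ite_eq F _ _

lemma czIntegral_eq_PhiTilde_add_PsiOp (hK : IsNormalisedKernel n γ K) (hγ : 0 < γ)
    (hF : ∀ q ∈ F, q.2.2 ≠ fun _ => false) (hc : ∀ q ∈ F, c q ≠ 0)
    (hx : x ∉ SigmaSet n (fun x => ∑ q ∈ F, c q * haarFn n q.1 q.2.1 q.2.2 x) s) :
    czIntegral K (fun x => ∑ q ∈ F, c q * haarFn n q.1 q.2.1 q.2.2 x) x =
      PhiTilde n K s (fun x => ∑ q ∈ F, c q * haarFn n q.1 q.2.1 q.2.2 x) x +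
        PsiOp n K s (fun x => ∑ q ∈ F, c q * haarFn n q.1 q.2.1 q.2.2 x) x := by
  rw [PhiTilde_eq_sum hF hc hx, PsiOp_eq_sum hK hγ hF hc hx, ← Finset.sum_add_distrib,
    czIntegral_sum F c _ fun q hq =>
      integrable_kernel_mul_haarFn hK hγ hF hc hx hq (mem_dyadicCube_floor _ x)]
  refine Finset.sum_congr rfl fun q _ => ?_
  ring

end OffSigma

/-- The decomposition (2.8): `Tf = Φ̃_s f + Ψ_s f` a.e. on `Σ_{f,s}^c`, for `f` with a
finite Haar expansion. -/
theorem statement18 (n : ℕ) (hn : 0 < n) (γ : ℝ) (hγ0 : 0 < γ) (hγ1 : γ ≤ 1) :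
    ∀ K : (Fin n → ℝ) → (Fin n → ℝ) → ℝ, IsNormalisedKernel n γ K →
    ∀ s : ℕ,
    ∀ (F : Finset (ℤ × (Fin n → ℤ) × (Fin n → Bool)))
      (c : ℤ × (Fin n → ℤ) × (Fin n → Bool) → ℝ),
      (∀ q ∈ F, q.2.2 ≠ (fun _ => false)) →
    ∀ f : (Fin n → ℝ) → ℝ,
      (f = fun x => ∑ q ∈ F, c q * haarFn n q.1 q.2.1 q.2.2 x) →
      ∀ᵐ x ∂(volume : Measure (Fin n → ℝ)), x ∈ (SigmaSet n f s)ᶜ →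
        czIntegral K f x = PhiTilde n K s f x + PsiOp n K s f x := by
  intro K hK s F c hF f hf
  refine Filter.Eventually.of_forall fun x hx => ?_
  have hf' : f = fun x => ∑ q ∈ F with c q ≠ 0, c q * haarFn n q.1 q.2.1 q.2.2 x := by
    rw [hf]
    ext y
    refine (Finset.sum_filter_of_ne fun q _ h => ?_).symm
    exact left_ne_zero_of_mul h
  rw [hf'] at hx ⊢
  exact czIntegral_eq_PhiTilde_add_PsiOp hK hγ0 (fun q hq => hF q (Finset.mem_filter.1 hq).1)
    (fun q hq => (Finset.mem_filter.1 hq).2) hx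

end
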